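/- arXiv:2604.11712 — 3 statements merged into one kernel-verified Lean document; each statement's English description precedes it below -/
import Mathlib

section
/- Under the stated hypotheses, the metric projection point x̄ and the proximal point x̂ satisfy ‖x̄ − x̂‖ ≤ γ·L·‖x − x̂‖. -/
open scoped RealInnerProductSpace

/-- Two points satisfying each other's projection variational inequality are no farther apart
than the points being projected. -/
theorem norm_sub_le_of_inner_sub_nonpos {E : Type*} [NormedAddCommGroup E]
    [InnerProductSpace ℝ E] {p q a b : E}
    (ha : ⟪p - a, b - a⟫ ≤ 0) (hb : ⟪q - b, a - b⟫ ≤ 0) :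
    ‖a - b‖ ≤ ‖p - q‖ := by
  have key : ‖a - b‖ * ‖a - b‖ ≤ ⟪p - q, a - b⟫ := by
    have h : ⟪p - q, a - b⟫ - ⟪a - b, a - b⟫ = -(⟪p - a, b - a⟫ + ⟪q - b, a - b⟫) := by
      rw [← neg_sub a b, inner_neg_right, ← inner_sub_left, neg_add, neg_neg,
        ← sub_eq_add_neg, ← inner_sub_left]
      congr 1
      abel
    rw [← real_inner_self_eq_norm_mul_norm]
    linarith
  have hcs := key.trans (real_inner_le_norm _ _)
  by_contra! hlt
  nlinarith [norm_nonneg (p - q)]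

/-- With `x̄` the metric projection of `x − γ∇ℓ(x)` onto `C`
(characterized by its variational inequality) and `x̂` the proximal point
(characterized by the proximal first-order condition), it holds that
`‖x̄ − x̂‖ ≤ γ·L·‖x − x̂‖`. -/
theorem projection_prox_distance_bound {n : ℕ}
    (C : Set (EuclideanSpace ℝ (Fin n)))
    (hCne : C.Nonempty) (hCcl : IsClosed C) (hCconv : Convex ℝ C)
    (ℓ : EuclideanSpace ℝ (Fin n) → ℝ)
    (gl : EuclideanSpace ℝ (Fin n) → EuclideanSpace ℝ (Fin n))
    (hgrad : ∀ u, HasGradientAt ℓ (gl u) u)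
    (L : ℝ) (hL : 0 < L)
    (hLip : ∀ u v, ‖gl u - gl v‖ ≤ L * ‖u - v‖)
    (γ : ℝ) (hγ : 0 < γ)
    (x xbar xhat : EuclideanSpace ℝ (Fin n))
    (hxbarC : xbar ∈ C) (hxhatC : xhat ∈ C)
    (hbar : ∀ z ∈ C, ⟪x - γ • gl x - xbar, z - xbar⟫ ≤ 0)
    (hhat : ∀ z ∈ C, ⟪x - γ • gl xhat - xhat, z - xhat⟫ ≤ 0) :
    ‖xbar - xhat‖ ≤ γ * L * ‖x - xhat‖ := by
  calc ‖xbar - xhat‖ ≤ ‖(x - γ • gl x) - (x - γ • gl xhat)‖ :=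
        norm_sub_le_of_inner_sub_nonpos (hbar xhat hxhatC) (hhat xbar hxbarC)
    _ = γ * ‖gl x - gl xhat‖ := by
        rw [sub_sub_sub_cancel_left, ← smul_sub, norm_smul, Real.norm_of_nonneg hγ.le,
          norm_sub_rev]
    _ ≤ γ * (L * ‖x - xhat‖) := by gcongr; exact hLip x xhat
    _ = γ * L * ‖x - xhat‖ := by ring
end

section
/- Under the stated hypotheses and assuming additionally γ·L < 1, it holds that ‖x − x̂‖ ≤ (1/(1 − γ·L))·‖x − x̄‖. -/
open scoped RealInnerProductSpace

/-- Under the hypotheses of Statement 10 and assuming in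
addition `γ·L < 1`, it holds that `‖x − x̂‖ ≤ (1/(1 − γ·L))·‖x − x̄‖`. -/
theorem prox_distance_via_projection {n : ℕ}
    (C : Set (EuclideanSpace ℝ (Fin n)))
    (hCne : C.Nonempty) (hCcl : IsClosed C) (hCconv : Convex ℝ C)
    (ℓ : EuclideanSpace ℝ (Fin n) → ℝ)
    (gl : EuclideanSpace ℝ (Fin n) → EuclideanSpace ℝ (Fin n))
    (hgrad : ∀ u, HasGradientAt ℓ (gl u) u)
    (L : ℝ) (hL : 0 < L)
    (hLip : ∀ u v, ‖gl u - gl v‖ ≤ L * ‖u - v‖)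
    (γ : ℝ) (hγ : 0 < γ) (hγL : γ * L < 1)
    (x xbar xhat : EuclideanSpace ℝ (Fin n))
    (hxbarC : xbar ∈ C) (hxhatC : xhat ∈ C)
    (hbar : ∀ z ∈ C, ⟪x - γ • gl x - xbar, z - xbar⟫ ≤ 0)
    (hhat : ∀ z ∈ C, ⟪x - γ • gl xhat - xhat, z - xhat⟫ ≤ 0) :
    ‖x - xhat‖ ≤ (1 / (1 - γ * L)) * ‖x - xbar‖ := by
  have hne : ‖xbar - xhat‖ ≤ γ * (L * ‖x - xhat‖) := calc
    ‖xbar - xhat‖ ≤ ‖(x - γ • gl x) - (x - γ • gl xhat)‖ :=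
      norm_sub_le_of_inner_sub_nonpos (hbar xhat hxhatC) (hhat xbar hxbarC)
    _ = γ * ‖gl x - gl xhat‖ := by
      rw [sub_sub_sub_cancel_left, ← smul_sub, norm_smul, Real.norm_of_nonneg hγ.le,
        norm_sub_rev]
    _ ≤ γ * (L * ‖x - xhat‖) := by gcongr; exact hLip x xhat
  have htri := norm_sub_le_norm_sub_add_norm_sub x xbar xhat
  rw [one_div_mul_eq_div, le_div_iff₀ (sub_pos.mpr hγL)]
  linarith
end

section
/- Let W : ℝ^n → ℝ be differentiable with L_W-Lipschitz gradient, let x, x̄, x̂ ∈ ℝ^n, let γ > 0 and δ ∈ (0, 1], and suppose ∇W(x) = (1/γ)·(x − x̂) and 2·⟨x − x̂, x − x̄⟩ ≥ ‖x − x̄‖². Then W(x − δ·(x − x̄)) − W(x) ≤ −δ·(1/(2γ) − L_W/2)·‖x − x̄‖². -/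
open scoped RealInnerProductSpace

/-- The descent inequality for a function with `L`-Lipschitz gradient. -/
theorem HasGradientAt.descent_inequality {E : Type*} [NormedAddCommGroup E]
    [InnerProductSpace ℝ E] [CompleteSpace E] {f : E → ℝ} {f' : E → E} {L : ℝ}
    (hf : ∀ u, HasGradientAt f (f' u) u) (hL : ∀ u v, ‖f' u - f' v‖ ≤ L * ‖u - v‖) (u d : E) :
    f (u + d) ≤ f u + ⟪f' u, d⟫ + L / 2 * ‖d‖ ^ 2 := by
  have hline (t : ℝ) : HasDerivAt (fun s : ℝ => f (u + s • d)) ⟪f' (u + t • d), d⟫ t := by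
    have hd : HasDerivAt (fun s : ℝ => u + s • d) d t := by
      simpa using ((hasDerivAt_id t).smul_const d).const_add u
    exact (hf (u + t • d)).hasFDerivAt.comp_hasDerivAt t hd
  have hbound (t : ℝ) : HasDerivAt
      (fun s : ℝ => f u + s * ⟪f' u, d⟫ + L / 2 * ‖d‖ ^ 2 * s ^ 2)
      (⟪f' u, d⟫ + L * ‖d‖ ^ 2 * t) t := by
    refine ((((hasDerivAt_id t).mul_const ⟪f' u, d⟫).const_add (f u)).add
      ((hasDerivAt_pow 2 t).const_mul (L / 2 * ‖d‖ ^ 2))).congr_deriv ?_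
    push_cast
    ring
  have h := image_le_of_deriv_right_le_deriv_boundary (a := 0) (b := 1)
    (fun t _ => (hline t).continuousAt.continuousWithinAt)
    (fun t _ => (hline t).hasDerivWithinAt) (by simp)
    (fun t _ => (hbound t).continuousAt.continuousWithinAt)
    (fun t _ => (hbound t).hasDerivWithinAt) ?_ (Set.right_mem_Icc.2 zero_le_one)
  · simpa using h
  · intro t ht
    rw [← sub_le_iff_le_add', ← inner_sub_left]
    calc ⟪f' (u + t • d) - f' u, d⟫ ≤ ‖f' (u + t • d) - f' u‖ * ‖d‖ := real_inner_le_norm _ _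
      _ ≤ L * ‖u + t • d - u‖ * ‖d‖ := by gcongr; exact hL _ _
      _ = L * ‖d‖ ^ 2 * t := by
        rw [add_sub_cancel_left, norm_smul, Real.norm_of_nonneg ht.1]
        ring

/-- If `W` has `L_W`-Lipschitz gradient, `∇W(x) = (1/γ)(x − x̂)`,
and `2⟪x − x̂, x − x̄⟫ ≥ ‖x − x̄‖²`, then for `δ ∈ (0,1]`,
`W(x − δ(x − x̄)) − W(x) ≤ −δ·(1/(2γ) − L_W/2)·‖x − x̄‖²`. -/
theorem moreau_descent_step {n : ℕ}
    (W : EuclideanSpace ℝ (Fin n) → ℝ)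
    (gW : EuclideanSpace ℝ (Fin n) → EuclideanSpace ℝ (Fin n))
    (hgrad : ∀ u, HasGradientAt W (gW u) u)
    (LW : ℝ)
    (hLip : ∀ u v, ‖gW u - gW v‖ ≤ LW * ‖u - v‖)
    (x xbar xhat : EuclideanSpace ℝ (Fin n))
    (γ δ : ℝ) (hγ : 0 < γ) (hδ : δ ∈ Set.Ioc (0 : ℝ) 1)
    (hgx : gW x = (1 / γ) • (x - xhat))
    (hinner : 2 * ⟪x - xhat, x - xbar⟫ ≥ ‖x - xbar‖ ^ 2) :
    W (x - δ • (x - xbar)) - W x ≤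
      -δ * (1 / (2 * γ) - LW / 2) * ‖x - xbar‖ ^ 2 := by
  obtain ⟨hδ0, hδ1⟩ := hδ
  have hdesc := HasGradientAt.descent_inequality hgrad hLip x (-(δ • (x - xbar)))
  rw [← sub_eq_add_neg, norm_neg, norm_smul, Real.norm_of_nonneg hδ0.le, hgx, inner_neg_right,
    real_inner_smul_left, real_inner_smul_right] at hdesc
  have hLD : 0 ≤ LW * ‖x - xbar‖ ^ 2 := by
    have h := mul_nonneg ((norm_nonneg _).trans (hLip x xbar)) (norm_nonneg (x - xbar))
    rwa [mul_assoc, ← sq] at h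
  have hquad := mul_le_mul_of_nonneg_right (mul_le_of_le_one_left hδ0.le hδ1) hLD
  have hlin := mul_le_mul_of_nonneg_left hinner (by positivity : 0 ≤ δ * (1 / γ))
  have hhalf : 1 / (2 * γ) = 1 / γ / 2 := by
    field_simp
  rw [hhalf]
  linarith
end
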